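/- Assume 0 < β < 1. Let f : Q → ℝ be continuous and obey the parabolic growth condition, let ψ be continuous on cl(Q) and obey the parabolic growth condition, and let g : ∂Q → ℝ be continuous, obey the parabolic growth condition, and satisfy ψ ≤ g on ∂Q. If u₁ and u₂ are both continuous on Q ∪ ∂Q, belong to C²(Q), each uᵢ and A uᵢ obey the parabolic growth condition on Q, and each uᵢ satisfies min{−∂_t uᵢ + A uᵢ − f, uᵢ − ψ} = 0 on Q and uᵢ = g on ∂Q (i = 1, 2), then u₁ = u₂ on Q ∪ ∂Q. -/

import Mathlib

open Real Set MeasureTheory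

noncomputable section

/-- First directional derivative of `u` at `z` in direction `v`. -/
def D1 (u : ℝ × ℝ → ℝ) (z v : ℝ × ℝ) : ℝ := fderiv ℝ u z v

/-- Second directional derivative of `u` at `z` in directions `v`, `w`. -/
def D2 (u : ℝ × ℝ → ℝ) (z v w : ℝ × ℝ) : ℝ := fderiv ℝ (fun z' => fderiv ℝ u z' v) z w

/-- The elliptic Heston operator
`(Au)(x,y) = −(y/2)(u_xx + 2ρσ u_xy + σ² u_yy) − (r − q − y/2) u_x − κ(θ − y) u_y + r u`. -/
def hestonA (σ ρ κ θ q r : ℝ) (u : ℝ × ℝ → ℝ) (z : ℝ × ℝ) : ℝ :=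
  -(z.2 / 2) * (D2 u z (1, 0) (1, 0) + 2 * ρ * σ * D2 u z (1, 0) (0, 1)
      + σ ^ 2 * D2 u z (0, 1) (0, 1))
    - (r - q - z.2 / 2) * D1 u z (1, 0) - κ * (θ - z.2) * D1 u z (0, 1) + r * u z

/-- The open upper half-plane `ℍ = ℝ × (0,∞)`. -/
def HH : Set (ℝ × ℝ) := {z | 0 < z.2}

/-- `Γ₁ = ∂O ∩ ℍ`. -/
def Gamma1 (O : Set (ℝ × ℝ)) : Set (ℝ × ℝ) := frontier O ∩ HH

/-- `Γ₀`: the interior, relative to `∂ℍ = ℝ × {0}`, of `∂ℍ ∩ ∂O`. -/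
def Gamma0 (O : Set (ℝ × ℝ)) : Set (ℝ × ℝ) :=
  {z | z.2 = 0 ∧ z.1 ∈ interior {x : ℝ | (x, (0 : ℝ)) ∈ frontier O}}

/-- The elliptic growth condition: `|v(x,y)| ≤ C (1 + e^{M₁ y} + e^{M₂ x})` on `S`,
with `0 ≤ M₁ < min (r/(κθ)) μ`, `μ = 2κ/σ²`, and `M₂ ∈ [0,1)`. -/
def ellGrowth (σ κ θ r : ℝ) (S : Set (ℝ × ℝ)) (v : ℝ × ℝ → ℝ) : Prop :=
  ∃ C M₁ M₂ : ℝ, 0 < C ∧ 0 ≤ M₁ ∧ M₁ < min (r / (κ * θ)) (2 * κ / σ ^ 2) ∧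
    0 ≤ M₂ ∧ M₂ < 1 ∧ ∀ z ∈ S, |v z| ≤ C * (1 + exp (M₁ * z.2) + exp (M₂ * z.1))

/-- Time derivative `u_t` at `p = (t, z)`. -/
def Dt (u : ℝ × (ℝ × ℝ) → ℝ) (p : ℝ × (ℝ × ℝ)) : ℝ := deriv (fun s => u (s, p.2)) p.1

/-- The Heston operator acting in the spatial variables for each fixed time. -/
def hestonP (σ ρ κ θ q r : ℝ) (u : ℝ × (ℝ × ℝ) → ℝ) (p : ℝ × (ℝ × ℝ)) : ℝ :=
  hestonA σ ρ κ θ q r (fun z => u (p.1, z)) p.2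

/-- The parabolic cylinder `Q = (0,T) × O`. -/
def parQ (T : ℝ) (O : Set (ℝ × ℝ)) : Set (ℝ × (ℝ × ℝ)) := Ioo (0 : ℝ) T ×ˢ O

/-- The partial parabolic boundary `∂¹Q = (0,T) × Γ₁ ∪ {T} × (O ∪ Γ₁)`. -/
def parB1 (T : ℝ) (O : Set (ℝ × ℝ)) : Set (ℝ × (ℝ × ℝ)) :=
  Ioo (0 : ℝ) T ×ˢ Gamma1 O ∪ ({T} : Set ℝ) ×ˢ (O ∪ Gamma1 O)

/-- The full parabolic boundary `∂Q = (0,T) × ∂O ∪ {T} × cl(O)`. -/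
def parB (T : ℝ) (O : Set (ℝ × ℝ)) : Set (ℝ × (ℝ × ℝ)) :=
  Ioo (0 : ℝ) T ×ˢ frontier O ∪ ({T} : Set ℝ) ×ˢ closure O

/-- The parabolic growth condition: `|v(t,x,y)| ≤ C (1 + e^{M₁ y} + e^{M₂ x})` on `S`,
with `0 ≤ M₁ < μ = 2κ/σ²` and `M₂ ∈ [0,1]`. -/
def parabGrowth (σ κ : ℝ) (S : Set (ℝ × (ℝ × ℝ))) (v : ℝ × (ℝ × ℝ) → ℝ) : Prop :=
  ∃ C M₁ M₂ : ℝ, 0 < C ∧ 0 ≤ M₁ ∧ M₁ < 2 * κ / σ ^ 2 ∧ 0 ≤ M₂ ∧ M₂ ≤ 1 ∧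
    ∀ p ∈ S, |v p| ≤ C * (1 + exp (M₁ * p.2.2) + exp (M₂ * p.2.1))

/-- `u ∈ C²(Q)`: the time derivative `u_t` and the spatial derivatives `Du`, `D²u` exist
and are continuous on `Q`. -/
def C2Parab (Q : Set (ℝ × (ℝ × ℝ))) (u : ℝ × (ℝ × ℝ) → ℝ) : Prop :=
  (∀ p ∈ Q, DifferentiableAt ℝ (fun s => u (s, p.2)) p.1) ∧
  ContinuousOn (fun p => Dt u p) Q ∧
  (∀ p ∈ Q, DifferentiableAt ℝ (fun z => u (p.1, z)) p.2) ∧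
  ContinuousOn (fun p => fderiv ℝ (fun z => u (p.1, z)) p.2) Q ∧
  (∀ p ∈ Q, DifferentiableAt ℝ (fun z => fderiv ℝ (fun z' => u (p.1, z')) z) p.2) ∧
  ContinuousOn (fun p => fderiv ℝ (fun z => fderiv ℝ (fun z' => u (p.1, z')) z) p.2) Q

/-- `min{−u_t + Au − f, u − ψ} = 0` on `Q`: `−u_t + Au ≥ f` and `u ≥ ψ` on `Q`, and at each
point of `Q` at least one of `−u_t + Au = f`, `u = ψ` holds. -/
def parabObstacleProblem (σ ρ κ θ q r : ℝ) (Q : Set (ℝ × (ℝ × ℝ)))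
    (f ψ u : ℝ × (ℝ × ℝ) → ℝ) : Prop :=
  ∀ p ∈ Q, f p ≤ -Dt u p + hestonP σ ρ κ θ q r u p ∧ ψ p ≤ u p ∧
    (-Dt u p + hestonP σ ρ κ θ q r u p = f p ∨ u p = ψ p)

section helpers

open Filter Topology

def Reg (v : ℝ × ℝ → ℝ) (z : ℝ × ℝ) : Prop :=
  (∀ᶠ z' in 𝓝 z, DifferentiableAt ℝ v z') ∧ DifferentiableAt ℝ (fderiv ℝ v) z

lemma D2_eq {v : ℝ × ℝ → ℝ} {z : ℝ × ℝ} (h : Reg v z) (a b : ℝ × ℝ) :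
    D2 v z a b = fderiv ℝ (fderiv ℝ v) z b a := by
  unfold D2
  rw [fderiv_clm_apply h.2 (differentiableAt_const a)]
  simp

lemma Reg.sub {u v : ℝ × ℝ → ℝ} {z : ℝ × ℝ} (hu : Reg u z) (hv : Reg v z) :
    Reg (fun z => u z - v z) z ∧
    fderiv ℝ (fun z => u z - v z) z = fderiv ℝ u z - fderiv ℝ v z ∧
    fderiv ℝ (fderiv ℝ (fun z => u z - v z)) z
      = fderiv ℝ (fderiv ℝ u) z - fderiv ℝ (fderiv ℝ v) z := by
  have h1 : fderiv ℝ (fun z => u z - v z) =ᶠ[𝓝 z] fun z => fderiv ℝ u z - fderiv ℝ v z := by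
    filter_upwards [hu.1, hv.1] with y h1 h2
    exact fderiv_fun_sub h1 h2
  refine ⟨⟨?_, ?_⟩, h1.self_of_nhds, ?_⟩
  · filter_upwards [hu.1, hv.1] with y h1 h2
    exact h1.sub h2
  · exact (hu.2.sub hv.2).congr_of_eventuallyEq h1
  · rw [h1.fderiv_eq, fderiv_fun_sub hu.2 hv.2]

lemma hestonA_sub (σ ρ κ θ q r : ℝ) {u v : ℝ × ℝ → ℝ} {z : ℝ × ℝ} (hu : Reg u z)
    (hv : Reg v z) : hestonA σ ρ κ θ q r (fun z => u z - v z) z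
      = hestonA σ ρ κ θ q r u z - hestonA σ ρ κ θ q r v z := by
  obtain ⟨h, h1, h2⟩ := hu.sub hv
  unfold hestonA D1
  simp only [D2_eq h, D2_eq hu, D2_eq hv, h1, h2]
  simp only [sub_apply]
  ring

lemma expF (c d a b : ℝ) (z : ℝ × ℝ) :
    HasFDerivAt (fun z : ℝ × ℝ => c * exp (d + a * z.1 + b * z.2))
      ((c * exp (d + a * z.1 + b * z.2)) •
        (a • ContinuousLinearMap.fst ℝ ℝ ℝ + b • ContinuousLinearMap.snd ℝ ℝ ℝ)) z := by
  have h1 : HasFDerivAt (fun z : ℝ × ℝ => d + a * z.1 + b * z.2)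
      (a • ContinuousLinearMap.fst ℝ ℝ ℝ + b • ContinuousLinearMap.snd ℝ ℝ ℝ) z := by
    have := ((hasFDerivAt_fst (𝕜 := ℝ) (E := ℝ) (F := ℝ) (p := z)).const_mul a).const_add d
    exact this.add ((hasFDerivAt_snd (𝕜 := ℝ) (E := ℝ) (F := ℝ) (p := z)).const_mul b)
  have := h1.exp.const_mul c
  rw [smul_smul] at this
  exact this

lemma exp_fderiv (c d a b : ℝ) :
    fderiv ℝ (fun z : ℝ × ℝ => c * exp (d + a * z.1 + b * z.2)) =
      fun z => (c * exp (d + a * z.1 + b * z.2)) •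
        (a • ContinuousLinearMap.fst ℝ ℝ ℝ + b • ContinuousLinearMap.snd ℝ ℝ ℝ) := by
  funext z
  exact (expF c d a b z).fderiv

lemma exp_reg (c d a b : ℝ) (z : ℝ × ℝ) :
    Reg (fun z : ℝ × ℝ => c * exp (d + a * z.1 + b * z.2)) z := by
  refine ⟨Eventually.of_forall fun z => (expF c d a b z).differentiableAt, ?_⟩
  rw [exp_fderiv]
  exact (expF c d a b z).differentiableAt.smul_const _

lemma hestonA_exp (σ ρ κ θ q r c d a b : ℝ) (z : ℝ × ℝ) :
    hestonA σ ρ κ θ q r (fun z : ℝ × ℝ => c * exp (d + a * z.1 + b * z.2)) z =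
     (c * exp (d + a * z.1 + b * z.2)) * (-(z.2 / 2) * (a ^ 2 + 2 * ρ * σ * a * b + σ ^ 2 * b ^ 2)
      - (r - q - z.2 / 2) * a - κ * (θ - z.2) * b + r) := by
  unfold hestonA D1
  simp only [D2_eq (exp_reg c d a b z)]
  have h2 : fderiv ℝ (fun z : ℝ × ℝ => (c * exp (d + a * z.1 + b * z.2)) •
        (a • ContinuousLinearMap.fst ℝ ℝ ℝ + b • ContinuousLinearMap.snd ℝ ℝ ℝ)) z = _ :=
    ((expF c d a b z).smul_const
      (a • ContinuousLinearMap.fst ℝ ℝ ℝ + b • ContinuousLinearMap.snd ℝ ℝ ℝ)).fderiv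
  rw [exp_fderiv, h2]
  simp
  ring

lemma second_test {g : ℝ → ℝ} (h : IsLocalMax g 0) (hc : ContinuousAt g 0) :
    deriv (deriv g) 0 ≤ 0 := by
  by_contra! hpos
  have hmin := isLocalMin_of_deriv_deriv_pos hpos h.deriv_eq_zero hc
  have hconst : g =ᶠ[𝓝 0] fun _ => g 0 := by
    filter_upwards [h, hmin] with x h1 h2
    exact le_antisymm h1 h2
  have h2 : deriv g =ᶠ[𝓝 0] fun _ => 0 := by
    have := hconst.deriv
    simpa using this
  rw [h2.deriv_eq] at hpos
  simp at hpos

lemma second_dir {v : ℝ × ℝ → ℝ} {z : ℝ × ℝ} (h : Reg v z) (hm : IsLocalMax v z) (e : ℝ × ℝ) :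
    fderiv ℝ (fderiv ℝ v) z e e ≤ 0 := by
  have hl : ∀ s : ℝ, HasDerivAt (fun s : ℝ => z + s • e) e s := fun s => by
    simpa using ((hasDerivAt_id s).smul_const e).const_add z
  have hc : Tendsto (fun s : ℝ => z + s • e) (𝓝 0) (𝓝 z) := by
    have := (hl 0).continuousAt.tendsto
    simpa using this
  have h1 : deriv (fun s : ℝ => v (z + s • e)) =ᶠ[𝓝 0] fun s => fderiv ℝ v (z + s • e) e := by
    filter_upwards [hc.eventually h.1] with s hs
    exact (hs.hasFDerivAt.comp_hasDerivAt s (hl s)).deriv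
  have h2 : HasDerivAt (fun s : ℝ => fderiv ℝ v (z + s • e) e)
      (fderiv ℝ (fderiv ℝ v) z e e) 0 := by
    have hz : HasFDerivAt (fderiv ℝ v) (fderiv ℝ (fderiv ℝ v) z) (z + (0:ℝ) • e) := by
      simpa using h.2.hasFDerivAt
    have := hz.comp_hasDerivAt (0:ℝ) (hl 0)
    simpa using this.clm_apply (hasDerivAt_const (0:ℝ) e)
  have h3 : IsLocalMax (fun s : ℝ => v (z + s • e)) 0 := by
    have := hc.eventually hm
    unfold IsLocalMax IsMaxFilter
    simpa using this
  have h4 : ContinuousAt (fun s : ℝ => v (z + s • e)) 0 := by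
    have : ContinuousAt v (z + (0:ℝ) • e) := by
      simpa using h.1.self_of_nhds.continuousAt
    exact ContinuousAt.comp (f := fun s : ℝ => z + s • e) this (hl 0).continuousAt
  have := second_test h3 h4
  rwa [h1.deriv_eq, h2.deriv] at this

lemma hestonA_max (σ ρ κ θ q r : ℝ) (hρ₁ : -1 < ρ) (hρ₂ : ρ < 1) {v : ℝ × ℝ → ℝ} {z : ℝ × ℝ}
    (h : Reg v z) (hz : 0 < z.2) (hm : IsLocalMax v z) :
    r * v z ≤ hestonA σ ρ κ θ q r v z := by
  have h0 := hm.fderiv_eq_zero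
  have hs : ∀ a b, fderiv ℝ (fderiv ℝ v) z a b = fderiv ℝ (fderiv ℝ v) z b a := fun a b =>
    second_derivative_symmetric_of_eventually (f := v) (f' := fderiv ℝ v)
      (h.1.mono fun y hy => hy.hasFDerivAt) h.2.hasFDerivAt a b
  have h1 := second_dir h hm ((1, 0) + (ρ * σ) • (0, 1))
  have h2 := second_dir h hm (0, 1)
  simp only [map_add, map_smul, add_apply, smul_apply, smul_eq_mul] at h1
  rw [hs (0, 1) (1, 0)] at h1
  unfold hestonA D1
  simp only [D2_eq h, h0]
  rw [hs (0, 1) (1, 0)]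
  simp only [zero_apply, mul_zero, sub_zero]
  generalize fderiv ℝ (fderiv ℝ v) z (1, 0) (1, 0) = A at *
  generalize fderiv ℝ (fderiv ℝ v) z (1, 0) (0, 1) = B at *
  generalize fderiv ℝ (fderiv ℝ v) z (0, 1) (0, 1) = D at *
  have h3 : (1 - ρ ^ 2) * σ ^ 2 * D ≤ 0 :=
    mul_nonpos_of_nonneg_of_nonpos (mul_nonneg (by nlinarith) (sq_nonneg _)) h2
  have h4 : A + 2 * ρ * σ * B + σ ^ 2 * D ≤ 0 := by nlinarith
  have h5 := mul_nonneg_of_nonpos_of_nonpos (a := -(z.2 / 2)) (by linarith) h4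
  linarith

lemma deriv_right {g : ℝ → ℝ} {t τ : ℝ} (ht : t < τ) (hg : DifferentiableAt ℝ g t)
    (h : ∀ s, t ≤ s → s < τ → g s ≤ g t) : deriv g t ≤ 0 := by
  have h1 := hg.hasDerivAt.hasDerivWithinAt (s := Ioi t)
  rw [hasDerivWithinAt_iff_tendsto_slope' (by simp)] at h1
  refine le_of_tendsto h1 ?_
  filter_upwards [Ioo_mem_nhdsGT ht] with s hs
  rw [slope_def_field]
  exact div_nonpos_of_nonpos_of_nonneg (by linarith [h s hs.1.le hs.2]) (by linarith [hs.1])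

lemma bar_ineq {σ ρ κ θ q r M K L a b y δ : ℝ} (hκ : 0 < κ) (hθ : 0 < θ) (hM : 0 ≤ M)
    (hK : K = 4 + 2 * |ρ * σ| * (M + 1) + σ ^ 2 * (M + 1) ^ 2)
    (hL : L = 1 + 2 * |r - q| + κ * θ * (M + 1) + |r|)
    (ha : a = 2 ∨ a = -2) (hδ : 0 ≤ δ) (hKδ : K * δ ≤ 1) (hb : b = M + K * δ) (hy : 0 < y) :
    0 < L + K * y + (-(y / 2) * (a ^ 2 + 2 * ρ * σ * a * b + σ ^ 2 * b ^ 2)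
      - (r - q - y / 2) * a - κ * (θ - y) * b + r) := by
  have hK0 : 0 ≤ K := by rw [hK]; positivity
  have hb0 : 0 ≤ b := by rw [hb]; positivity
  have hb1 : b ≤ M + 1 := by linarith
  have h1 : b ^ 2 ≤ (M + 1) ^ 2 := by gcongr
  have h2 : σ ^ 2 * b ^ 2 ≤ σ ^ 2 * (M + 1) ^ 2 := by gcongr
  have h3 : |ρ * σ| * b ≤ |ρ * σ| * (M + 1) := by gcongr
  have h4 : κ * θ * b ≤ κ * θ * (M + 1) := by gcongr
  have h5 : 0 ≤ κ * b := by positivity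
  have h6 := neg_abs_le r
  have h7 : ρ * σ * b ≤ |ρ * σ| * b := by gcongr; exact le_abs_self _
  have h8 : -(|ρ * σ| * b) ≤ ρ * σ * b := by
    rw [← neg_mul]; gcongr; exact neg_abs_le _
  have h9 := le_abs_self (r - q)
  have h10 := neg_abs_le (r - q)
  have h12 : 0 ≤ σ ^ 2 * b ^ 2 := by positivity
  have hkey : 0 ≤ y * (K - (a ^ 2 + 2 * ρ * σ * a * b + σ ^ 2 * b ^ 2) / 2 + a / 2 + κ * b) := by
    apply mul_nonneg hy.le
    rcases ha with rfl | rfl <;> rw [hK] <;> linarith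
  have hkey2 : 0 < L - (r - q) * a - κ * θ * b + r := by
    rcases ha with rfl | rfl <;> rw [hL] <;> linarith
  linarith

lemma time_deriv (c L K M τ a x y t : ℝ) :
    HasDerivAt (fun t => c * exp (L * (τ - t) + a * x + (M + K * (τ - t)) * y))
      (-(c * exp (L * (τ - t) + a * x + (M + K * (τ - t)) * y) * (L + K * y))) t := by
  have h0 : HasDerivAt (fun t => τ - t) (-1) t := by
    simpa using (hasDerivAt_id t).const_sub τ
  have h1 : HasDerivAt (fun t => L * (τ - t) + a * x + (M + K * (τ - t)) * y)
      (L * (-1) + (K * (-1)) * y) t :=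
    ((h0.const_mul L).add_const (a * x)).add (((h0.const_mul K).const_add M).mul_const y)
  refine (h1.exp.const_mul c).congr_deriv ?_
  ring

lemma closure_nonneg {O : Set (ℝ × ℝ)} (hOsub : O ⊆ HH) {z : ℝ × ℝ} (hz : z ∈ closure O) :
    0 ≤ z.2 := by
  have h : IsClosed {z : ℝ × ℝ | 0 ≤ z.2} := isClosed_le continuous_const continuous_snd
  exact closure_minimal (t := {z : ℝ × ℝ | 0 ≤ z.2}) (fun z hz => le_of_lt (show 0 < z.2 from hOsub hz)) h hz

lemma C2Parab.reg {O : Set (ℝ × ℝ)} (hO : IsOpen O) {T : ℝ} {u : ℝ × (ℝ × ℝ) → ℝ}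
    (h : C2Parab (parQ T O) u) {t : ℝ} {z : ℝ × ℝ} (ht : t ∈ Ioo 0 T) (hz : z ∈ O) :
    Reg (fun z => u (t, z)) z := by
  obtain ⟨-, -, h3, -, h5, -⟩ := h
  refine ⟨?_, h5 (t, z) ⟨ht, hz⟩⟩
  filter_upwards [hO.mem_nhds hz] with y hy
  exact h3 (t, y) ⟨ht, hy⟩

lemma step (σ ρ κ θ q r : ℝ) (hρ₁ : -1 < ρ) (hρ₂ : ρ < 1)
    (hκ : 0 < κ) (hθ : 0 < θ)
    (O : Set (ℝ × ℝ)) (hO : IsOpen O) (hOsub : O ⊆ HH)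
    (T : ℝ) (f ψ u₁ u₂ : ℝ × (ℝ × ℝ) → ℝ)
    (hu₁c : ContinuousOn u₁ (parQ T O ∪ parB T O)) (hu₁d : C2Parab (parQ T O) u₁)
    (hu₁eq : parabObstacleProblem σ ρ κ θ q r (parQ T O) f ψ u₁)
    (hu₂c : ContinuousOn u₂ (parQ T O ∪ parB T O)) (hu₂d : C2Parab (parQ T O) u₂)
    (hu₂eq : parabObstacleProblem σ ρ κ θ q r (parQ T O) f ψ u₂)
    (hub : ∀ p ∈ parB T O, u₁ p = u₂ p)
    (C M K : ℝ) (hC : 0 < C) (hM : 0 ≤ M)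
    (hgr : ∀ p ∈ parQ T O, u₁ p - u₂ p ≤ C * exp (M * p.2.2 + |p.2.1|))
    (hK : K = 4 + 2 * |ρ * σ| * (M + 1 + 1) + σ ^ 2 * (M + 1 + 1) ^ 2)
    (s τ : ℝ) (hs : 0 < s) (hsτ : s ≤ τ) (hτT : τ ≤ T) (hKs : K * (τ - s) ≤ 1)
    (hw : ∀ z ∈ closure O, u₁ (τ, z) ≤ u₂ (τ, z)) :
    ∀ t ∈ Icc s τ, ∀ z ∈ closure O, u₁ (t, z) ≤ u₂ (t, z) := by
  by_contra! hcon
  obtain ⟨t0, ht0, z0, hz0, hlt⟩ := hcon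
  obtain ⟨L, hL⟩ : ∃ L, L = 1 + 2 * |r - q| + κ * θ * (M + 1 + 1) + |r| := ⟨_, rfl⟩
  have hK0 : 0 ≤ K := by rw [hK]; positivity
  have hL0 : 0 ≤ L := by rw [hL]; positivity
  let E : ℝ → ℝ → ℝ × (ℝ × ℝ) → ℝ := fun c a p =>
    c * exp (L * (τ - p.1) + a * p.2.1 + (M + 1 + K * (τ - p.1)) * p.2.2)
  let F : ℝ × (ℝ × ℝ) → ℝ := fun p => E 1 2 p + E 1 (-2) p
  have hFpos : ∀ p, 0 < F p := fun p => by simp only [F, E]; positivity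
  have hFcont : Continuous F := by simp only [F, E]; fun_prop
  have hEc : ∀ c a p, E c a p = c * E 1 a p := fun c a p => by simp only [E]; ring
  -- lower bound of F
  have hFlow : ∀ t z, t ≤ τ → 0 ≤ z.2 → exp (M * z.2 + |z.1|) * exp (|z.1| + z.2) ≤ F (t, z) := by
    intro t z ht hz
    rw [← exp_add]
    have e1 : 0 ≤ L * (τ - t) := mul_nonneg hL0 (by linarith)
    have e2 : 0 ≤ K * (τ - t) * z.2 := mul_nonneg (mul_nonneg hK0 (by linarith)) hz
    rcases abs_cases z.1 with ⟨h, -⟩ | ⟨h, -⟩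
    · have : exp (M * z.2 + |z.1| + (|z.1| + z.2)) ≤ E 1 2 (t, z) := by
        simp only [E, one_mul]
        apply exp_le_exp.2
        rw [h]; linarith
      have h2 : 0 < E 1 (-2) (t, z) := by simp only [E]; positivity
      simp only [F]; linarith
    · have : exp (M * z.2 + |z.1| + (|z.1| + z.2)) ≤ E 1 (-2) (t, z) := by
        simp only [E, one_mul]
        apply exp_le_exp.2
        rw [h]; linarith
      have h2 : 0 < E 1 2 (t, z) := by simp only [E]; positivity
      simp only [F]; linarith
  let W : ℝ × (ℝ × ℝ) → ℝ := fun p => u₁ p - u₂ p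
  have hdom : ∀ t ∈ Icc s τ, ∀ z ∈ closure O, (t, z) ∈ parQ T O ∪ parB T O := by
    intro t ht z hz
    rcases (ht.2.trans hτT).eq_or_lt with h | h
    · right; right; exact ⟨h, hz⟩
    · have htm : t ∈ Ioo 0 T := ⟨hs.trans_le ht.1, h⟩
      by_cases hzO : z ∈ O
      · left; exact ⟨htm, hzO⟩
      · right; left; exact ⟨htm, hz, by rwa [hO.interior_eq]⟩
  -- positivity implies interior
  have hint : ∀ t ∈ Icc s τ, ∀ z ∈ closure O, 0 < W (t, z) → t < τ ∧ t ∈ Ioo 0 T ∧ z ∈ O := by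
    intro t ht z hz hpos
    have htτ : t < τ := by
      refine lt_of_le_of_ne ht.2 ?_
      rintro rfl
      have := hw z hz
      simp only [W] at hpos; linarith
    rcases hdom t ht z hz with h | h
    · exact ⟨htτ, h.1, h.2⟩
    · have := hub _ h
      simp only [W] at hpos; linarith
  have hW0 : 0 < W (t0, z0) := by simp only [W]; linarith
  have hη : 0 < W (t0, z0) / F (t0, z0) := div_pos hW0 (hFpos _)
  set η := W (t0, z0) / F (t0, z0) with hηdef
  let R : ℝ := max (log (C / η)) ‖z0‖
  have hout : ∀ t ∈ Icc s τ, ∀ z ∈ closure O, R < ‖z‖ → W (t, z) < η * F (t, z) := by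
    intro t ht z hz hR
    by_cases hpos : 0 < W (t, z)
    · obtain ⟨-, h1, h2⟩ := hint t ht z hz hpos
      have hz2 : 0 < z.2 := hOsub h2
      have hn : ‖z‖ ≤ |z.1| + z.2 := by
        rw [Prod.norm_def, Real.norm_eq_abs, Real.norm_eq_abs, abs_of_pos hz2]
        exact max_le (by linarith) (by linarith [abs_nonneg z.1])
      have h3 : log (C / η) < |z.1| + z.2 := ((le_max_left _ _).trans_lt hR).trans_le hn
      have h4 : C < η * exp (|z.1| + z.2) := by
        have := (log_lt_iff_lt_exp (div_pos hC hη)).1 h3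
        rw [div_lt_iff₀ hη] at this
        linarith
      calc W (t, z) ≤ C * exp (M * z.2 + |z.1|) := hgr (t, z) ⟨h1, h2⟩
        _ < (η * exp (|z.1| + z.2)) * exp (M * z.2 + |z.1|) := by gcongr
        _ = η * (exp (M * z.2 + |z.1|) * exp (|z.1| + z.2)) := by ring
        _ ≤ η * F (t, z) := by
          gcongr
          exact hFlow t z ht.2 hz2.le
    · have := mul_pos hη (hFpos (t, z))
      linarith
  let S : Set (ℝ × (ℝ × ℝ)) := Icc s τ ×ˢ (closure O ∩ Metric.closedBall 0 R)
  have hScomp : IsCompact S :=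
    isCompact_Icc.prod ((isCompact_closedBall _ _).inter_left isClosed_closure)
  have hS0 : (t0, z0) ∈ S := by
    refine ⟨ht0, hz0, ?_⟩
    rw [mem_closedBall_zero_iff]
    exact le_max_right _ _
  have hSsub : S ⊆ parQ T O ∪ parB T O := by
    rintro ⟨t, z⟩ ⟨ht, hz⟩
    exact hdom t ht z hz.1
  have hcont : ContinuousOn (fun p => W p / F p) S :=
    ((hu₁c.mono hSsub).sub (hu₂c.mono hSsub)).div hFcont.continuousOn fun p _ => (hFpos p).ne'
  obtain ⟨⟨t1, z1⟩, hp1, hmax⟩ := hScomp.exists_isMaxOn ⟨_, hS0⟩ hcont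
  obtain ⟨e, he⟩ : ∃ e, e = W (t1, z1) / F (t1, z1) := ⟨_, rfl⟩
  have hηe : η ≤ e := by rw [he]; exact hmax hS0
  have he0 : 0 < e := hη.trans_le hηe
  have hWe : W (t1, z1) = e * F (t1, z1) := by
    rw [he, div_mul_cancel₀ _ (hFpos _).ne']
  have hall : ∀ t ∈ Icc s τ, ∀ z ∈ closure O, W (t, z) ≤ e * F (t, z) := by
    intro t ht z hz
    by_cases hR : ‖z‖ ≤ R
    · have : W (t, z) / F (t, z) ≤ e := by
        rw [he]
        exact hmax (show (t, z) ∈ S from ⟨ht, hz, by rwa [mem_closedBall_zero_iff]⟩)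
      rwa [div_le_iff₀ (hFpos _)] at this
    · refine (hout t ht z hz (not_le.1 hR)).le.trans ?_
      exact mul_le_mul_of_nonneg_right hηe (hFpos _).le
  have hW1 : 0 < W (t1, z1) := by rw [hWe]; exact mul_pos he0 (hFpos _)
  have ht1 : t1 ∈ Icc s τ := hp1.1
  obtain ⟨h1τ, h1T, h1O⟩ := hint t1 ht1 z1 hp1.2.1 hW1
  have hz1 : 0 < z1.2 := hOsub h1O
  have hQ : (t1, z1) ∈ parQ T O := ⟨h1T, h1O⟩
  -- spatial
  have r1 := hu₁d.reg hO h1T h1O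
  have r2 := hu₂d.reg hO h1T h1O
  have r3 := exp_reg e (L * (τ - t1)) 2 (M + 1 + K * (τ - t1)) z1
  have r4 := exp_reg e (L * (τ - t1)) (-2) (M + 1 + K * (τ - t1)) z1
  have hmaxz : IsLocalMax (fun z : ℝ × ℝ => u₁ (t1, z) - u₂ (t1, z)
      - e * exp (L * (τ - t1) + 2 * z.1 + (M + 1 + K * (τ - t1)) * z.2)
      - e * exp (L * (τ - t1) + (-2) * z.1 + (M + 1 + K * (τ - t1)) * z.2)) z1 := by
    filter_upwards [hO.mem_nhds h1O] with z hz
    have := hall t1 ht1 z (subset_closure hz)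
    simp only [W, F, E, one_mul] at this hWe
    linarith
  have hA := hestonA_max σ ρ κ θ q r hρ₁ hρ₂ (((r1.sub r2).1.sub r3).1.sub r4).1 hz1 hmaxz
  rw [hestonA_sub σ ρ κ θ q r ((r1.sub r2).1.sub r3).1 r4,
    hestonA_sub σ ρ κ θ q r (r1.sub r2).1 r3, hestonA_sub σ ρ κ θ q r r1 r2,
    hestonA_exp, hestonA_exp] at hA
  -- time
  have d1 := (hu₁d.1 _ hQ).hasDerivAt
  have d2 := (hu₂d.1 _ hQ).hasDerivAt
  have d3 := time_deriv e L K (M + 1) τ 2 z1.1 z1.2 t1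
  have d4 := time_deriv e L K (M + 1) τ (-2) z1.1 z1.2 t1
  have dd := ((d1.sub d2).sub d3).sub d4
  have hDt := deriv_right h1τ dd.differentiableAt (by
    intro t h1 h2
    have := hall t ⟨ht1.1.trans h1, h2.le⟩ z1 hp1.2.1
    simp only [W, F, E, one_mul] at this hWe
    simp only [Pi.sub_apply]
    linarith)
  rw [dd.deriv] at hDt
  -- equations
  obtain ⟨-, -, q1⟩ := hu₁eq _ hQ
  obtain ⟨q2, q3, -⟩ := hu₂eq _ hQ
  have q4 : -Dt u₁ (t1, z1) + hestonP σ ρ κ θ q r u₁ (t1, z1) = f (t1, z1) := by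
    rcases q1 with h | h
    · exact h
    · simp only [W] at hW1; linarith
  unfold Dt hestonP at q2 q4
  have b1 := bar_ineq (q := q) (r := r) (a := 2) hκ hθ (by linarith : 0 ≤ M + 1) hK hL
    (Or.inl rfl) (sub_nonneg.2 ht1.2) (le_trans (by gcongr; exact ht1.1) hKs) rfl hz1
  have b2 := bar_ineq (q := q) (r := r) (a := -2) hκ hθ (by linarith : 0 ≤ M + 1) hK hL
    (Or.inr rfl) (sub_nonneg.2 ht1.2) (le_trans (by gcongr; exact ht1.1) hKs) rfl hz1
  have hv0 : u₁ (t1, z1) - u₂ (t1, z1)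
      - e * exp (L * (τ - t1) + 2 * z1.1 + (M + 1 + K * (τ - t1)) * z1.2)
      - e * exp (L * (τ - t1) + (-2) * z1.1 + (M + 1 + K * (τ - t1)) * z1.2) = 0 := by
    simp only [W, F, E, one_mul] at hWe
    linarith
  simp only [hv0, mul_zero] at hA
  have p1 : 0 < e * exp (L * (τ - t1) + 2 * z1.1 + (M + 1 + K * (τ - t1)) * z1.2) := by positivity
  have p2 : 0 < e * exp (L * (τ - t1) + (-2) * z1.1 + (M + 1 + K * (τ - t1)) * z1.2) := by
    positivity
  have c1 := mul_pos p1 b1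
  have c2 := mul_pos p2 b2
  simp only [mul_add (e * exp _) (L + K * z1.2)] at c1 c2
  linarith

lemma growth_simple {σ κ : ℝ} {S : Set (ℝ × (ℝ × ℝ))} {v : ℝ × (ℝ × ℝ) → ℝ}
    (h : parabGrowth σ κ S v) (hS : ∀ p ∈ S, 0 ≤ p.2.2) :
    ∃ C M : ℝ, 0 < C ∧ 0 ≤ M ∧ ∀ M', M ≤ M' → ∀ p ∈ S, |v p| ≤ C * exp (M' * p.2.2 + |p.2.1|) := by
  obtain ⟨C, M₁, M₂, hC, hM, -, h0, h1, hb⟩ := h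
  refine ⟨3 * C, M₁, by linarith, hM, fun M' hM' p hp => (hb p hp).trans ?_⟩
  have hy := hS p hp
  have hx := abs_nonneg p.2.1
  have hx2 := le_abs_self p.2.1
  have hmy := mul_le_mul_of_nonneg_right hM' hy
  have hmy0 : 0 ≤ M₁ * p.2.2 := by positivity
  have e1 : (1:ℝ) ≤ exp (M' * p.2.2 + |p.2.1|) := one_le_exp (by linarith)
  have e2 : exp (M₁ * p.2.2) ≤ exp (M' * p.2.2 + |p.2.1|) := exp_le_exp.2 (by linarith)
  have e3 : exp (M₂ * p.2.1) ≤ exp (M' * p.2.2 + |p.2.1|) := by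
    apply exp_le_exp.2
    have : M₂ * p.2.1 ≤ |p.2.1| := by
      calc M₂ * p.2.1 ≤ M₂ * |p.2.1| := by gcongr
        _ ≤ 1 * |p.2.1| := by gcongr
        _ = _ := one_mul _
    linarith
  calc C * (1 + exp (M₁ * p.2.2) + exp (M₂ * p.2.1))
      ≤ C * (exp (M' * p.2.2 + |p.2.1|) + exp (M' * p.2.2 + |p.2.1|)
        + exp (M' * p.2.2 + |p.2.1|)) := by gcongr
    _ = _ := by ring

lemma comparison (σ ρ κ θ q r : ℝ) (hρ₁ : -1 < ρ) (hρ₂ : ρ < 1)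
    (hκ : 0 < κ) (hθ : 0 < θ)
    (O : Set (ℝ × ℝ)) (hO : IsOpen O) (hOsub : O ⊆ HH)
    (T : ℝ) (f ψ u₁ u₂ : ℝ × (ℝ × ℝ) → ℝ)
    (hu₁c : ContinuousOn u₁ (parQ T O ∪ parB T O)) (hu₁d : C2Parab (parQ T O) u₁)
    (hu₁g : parabGrowth σ κ (parQ T O) u₁)
    (hu₁eq : parabObstacleProblem σ ρ κ θ q r (parQ T O) f ψ u₁)
    (hu₂c : ContinuousOn u₂ (parQ T O ∪ parB T O)) (hu₂d : C2Parab (parQ T O) u₂)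
    (hu₂g : parabGrowth σ κ (parQ T O) u₂)
    (hu₂eq : parabObstacleProblem σ ρ κ θ q r (parQ T O) f ψ u₂)
    (hub : ∀ p ∈ parB T O, u₁ p = u₂ p) :
    ∀ p ∈ parQ T O, u₁ p ≤ u₂ p := by
  have hS : ∀ p ∈ parQ T O, 0 ≤ p.2.2 := fun p hp => le_of_lt (hOsub hp.2)
  obtain ⟨C₁, M₁, hC₁, hM₁, g1⟩ := growth_simple hu₁g hS
  obtain ⟨C₂, M₂, hC₂, hM₂, g2⟩ := growth_simple hu₂g hS
  obtain ⟨M, hM⟩ : ∃ M, M = max M₁ M₂ := ⟨_, rfl⟩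
  have hM0 : 0 ≤ M := by rw [hM]; exact hM₁.trans (le_max_left _ _)
  obtain ⟨K, hK⟩ : ∃ K, K = 4 + 2 * |ρ * σ| * (M + 1 + 1) + σ ^ 2 * (M + 1 + 1) ^ 2 := ⟨_, rfl⟩
  have hKpos : 0 < K := by rw [hK]; positivity
  have hgr : ∀ p ∈ parQ T O, u₁ p - u₂ p ≤ (C₁ + C₂) * exp (M * p.2.2 + |p.2.1|) := by
    intro p hp
    have a1 := g1 M (by rw [hM]; exact le_max_left _ _) p hp
    have a2 := g2 M (by rw [hM]; exact le_max_right _ _) p hp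
    have := le_abs_self (u₁ p)
    have := neg_abs_le (u₂ p)
    linarith
  have hst := step σ ρ κ θ q r hρ₁ hρ₂ hκ hθ O hO hOsub T f ψ u₁ u₂ hu₁c hu₁d hu₁eq hu₂c hu₂d
    hu₂eq hub (C₁ + C₂) M K (by linarith) hM0 hgr hK
  have hind : ∀ n : ℕ, ∀ t, 0 < t → t ≤ T → T - n / K ≤ t → ∀ z ∈ closure O,
      u₁ (t, z) ≤ u₂ (t, z) := by
    intro n
    induction n with
    | zero =>
      intro t _ h1 h2 z hz
      have : t = T := by
        simp at h2; linarith
      exact (hub (t, z) (Or.inr ⟨this, hz⟩)).le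
    | succ n ih =>
      intro t h0 h1 h2 z hz
      have hinv : 0 < 1 / K := by positivity
      push_cast at h2
      rw [add_div] at h2
      have hle : t ≤ min T (t + 1 / K) := le_min h1 (by linarith)
      refine hst t (min T (t + 1 / K)) h0 hle (min_le_left _ _) ?_ ?_ t ⟨le_rfl, hle⟩ z hz
      · calc K * (min T (t + 1 / K) - t) ≤ K * (1 / K) := by
              gcongr; linarith [min_le_right T (t + 1 / K)]
          _ = 1 := by field_simp
      · apply ih _ (h0.trans_le hle) (min_le_left _ _)
        apply le_min
        · have : 0 ≤ (n : ℝ) / K := by positivity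
          linarith
        · linarith
  rintro ⟨t, z⟩ ⟨ht, hz⟩
  obtain ⟨n, hn⟩ := exists_nat_ge (T * K)
  refine hind n t ht.1 ht.2.le ?_ z (subset_closure hz)
  have : T ≤ n / K := by rwa [le_div_iff₀ hKpos]
  have := ht.1
  simp only at this
  linarith

end helpers

/-- Uniqueness of solutions to the parabolic Heston obstacle problem with full Dirichlet
boundary condition, when `0 < β < 1`. -/
theorem heston_parabolic_obstacle_uniqueness_beta_lt_one
    (σ ρ κ θ q r : ℝ) (hσ : σ ≠ 0) (hρ₁ : -1 < ρ) (hρ₂ : ρ < 1)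
    (hκ : 0 < κ) (hθ : 0 < θ)
    (hβ₀ : 0 < 2 * κ * θ / σ ^ 2) (hβ₁ : 2 * κ * θ / σ ^ 2 < 1)
    (O : Set (ℝ × ℝ)) (hO : IsOpen O) (hOconn : IsConnected O) (hOsub : O ⊆ HH)
    (hΓ₀ : (Gamma0 O).Nonempty)
    (T : ℝ) (hT : 0 < T)
    (f ψ g u₁ u₂ : ℝ × (ℝ × ℝ) → ℝ)
    (hf : ContinuousOn f (parQ T O)) (hfg : parabGrowth σ κ (parQ T O) f)
    (hψ : ContinuousOn ψ (closure (parQ T O)))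
    (hψg : parabGrowth σ κ (closure (parQ T O)) ψ)
    (hg : ContinuousOn g (parB T O)) (hgg : parabGrowth σ κ (parB T O) g)
    (hψle : ∀ p ∈ parB T O, ψ p ≤ g p)
    (hu₁c : ContinuousOn u₁ (parQ T O ∪ parB T O)) (hu₁d : C2Parab (parQ T O) u₁)
    (hu₁g : parabGrowth σ κ (parQ T O) u₁)
    (hAu₁g : parabGrowth σ κ (parQ T O) (hestonP σ ρ κ θ q r u₁))
    (hu₁eq : parabObstacleProblem σ ρ κ θ q r (parQ T O) f ψ u₁)
    (hu₁b : ∀ p ∈ parB T O, u₁ p = g p)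
    (hu₂c : ContinuousOn u₂ (parQ T O ∪ parB T O)) (hu₂d : C2Parab (parQ T O) u₂)
    (hu₂g : parabGrowth σ κ (parQ T O) u₂)
    (hAu₂g : parabGrowth σ κ (parQ T O) (hestonP σ ρ κ θ q r u₂))
    (hu₂eq : parabObstacleProblem σ ρ κ θ q r (parQ T O) f ψ u₂)
    (hu₂b : ∀ p ∈ parB T O, u₂ p = g p) :
    EqOn u₁ u₂ (parQ T O ∪ parB T O) := by
  have hub : ∀ p ∈ parB T O, u₁ p = u₂ p := fun p hp => by rw [hu₁b p hp, hu₂b p hp]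
  rintro p (hp | hp)
  · exact le_antisymm
      (comparison σ ρ κ θ q r hρ₁ hρ₂ hκ hθ O hO hOsub T f ψ u₁ u₂ hu₁c hu₁d hu₁g hu₁eq
        hu₂c hu₂d hu₂g hu₂eq hub p hp)
      (comparison σ ρ κ θ q r hρ₁ hρ₂ hκ hθ O hO hOsub T f ψ u₂ u₁ hu₂c hu₂d hu₂g hu₂eq
        hu₁c hu₁d hu₁g hu₁eq (fun p hp => (hub p hp).symm) p hp)
  · exact hub p hp

end
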